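/- Let Y = θ₀ + Z with Z ~ N(0, σ²Iₙ), σ > 0, and let {H_s}_{s∈S} be a finite collection of orthogonal projection matrices with tr(H_{s₀}) ≥ 1 for the risk minimizer s₀. Let ŝ(Y) be a measurable minimizer of SURE(s) = ‖Y − H_sY‖₂² + 2σ² tr(H_s), and let Risk(θ̂_{ŝ}) = E[‖H_{ŝ(Y)}Y − θ₀‖₂²]. Then there is a universal constant C such that Risk(θ̂_{ŝ}) ≤ R(s₀) + C(√(R(s₀) · σ² log|S|) + σ² log|S| · (1 + max{0, log(σ² log|S| / R(s₀))})), where R(s₀) = min_{s∈S}(‖(I − H_s)θ₀‖₂² + σ² tr(H_s)). -/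

import Mathlib

open MeasureTheory ProbabilityTheory Matrix Real

/-- The Gaussian measure `N(0, σ²Iₙ)` on `ℝⁿ` (the law of the noise `Z`). -/
noncomputable def gaussianVec (n : ℕ) (σ : ℝ) : Measure (Fin n → ℝ) :=
  Measure.pi fun _ : Fin n => gaussianReal 0 (σ ^ 2).toNNReal

/-- `SURE(s, y) = ‖y − H_s y‖² + 2σ² tr(H_s)`. -/
noncomputable def SUREf {n : ℕ} {S : Type} (σ : ℝ)
    (H : S → Matrix (Fin n) (Fin n) ℝ) (s : S) (y : Fin n → ℝ) : ℝ :=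
  (∑ i, (y i - (H s).mulVec y i) ^ 2) + 2 * σ ^ 2 * (H s).trace

/-- For projection estimators, `R(s) = ‖(I − H_s)θ₀‖² + σ² tr(H_s)`. -/
noncomputable def riskP {n : ℕ} {S : Type} (σ : ℝ) (θ₀ : Fin n → ℝ)
    (H : S → Matrix (Fin n) (Fin n) ℝ) (s : S) : ℝ :=
  (∑ i, (θ₀ i - (H s).mulVec θ₀ i) ^ 2) + σ ^ 2 * (H s).trace

instance gaussianVec.instIsProbabilityMeasure (n : ℕ) (σ : ℝ) :
    IsProbabilityMeasure (gaussianVec n σ) := by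
  unfold gaussianVec; infer_instance

/-- In an orthonormal basis, i.i.d. standard Gaussian coordinates scaled by `σ` give
`N(0, σ²Iₙ)`. -/
lemma measurePreserving_gaussianVec_orthonormalBasis {n : ℕ} (σ : ℝ)
    (b : OrthonormalBasis (Fin n) ℝ (EuclideanSpace ℝ (Fin n))) :
    MeasurePreserving (fun (x : Fin n → ℝ) (j : Fin n) => σ * ∑ i, x i * b i j)
      (Measure.pi fun _ => gaussianReal 0 1) (gaussianVec n σ) := by
  refine ⟨by fun_prop, ?_⟩
  have hscale : (Measure.pi fun _ : Fin n => gaussianReal 0 1).map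
      (fun x j => σ * x j) = gaussianVec n σ := by
    rw [Measure.pi_map_pi (μ := fun _ : Fin n => gaussianReal 0 1)
      (f := fun _ (x : ℝ) => σ * x) (by fun_prop)]
    simp only [gaussianReal_map_const_mul, mul_zero, mul_one, gaussianVec]
    congr! 3
    ext
    simp [sq_nonneg]
  have hrot := (map_pi_eq_stdGaussian (ι := Fin n)).trans
    (stdGaussian_eq_map_pi_orthonormalBasis b)
  have h := congrArg (Measure.map fun (x : EuclideanSpace ℝ (Fin n)) (j : Fin n) => σ * x j) hrot
  rw [Measure.map_map (by fun_prop) (by fun_prop),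
    Measure.map_map (by fun_prop) (by fun_prop)] at h
  rw [← hscale]
  refine Eq.trans ?_ h.symm
  congr 1
  ext x j
  simp

/-- A Gaussian vector diagonalizes the quadratic form of an orthogonal projection. -/
lemma exists_measurePreserving_projection {n : ℕ} (σ : ℝ) {P : Matrix (Fin n) (Fin n) ℝ}
    (hP : P * P = P) (hs : P.IsSymm) :
    ∃ (φ : (Fin n → ℝ) → Fin n → ℝ) (e : Fin n → ℝ),
      MeasurePreserving φ (Measure.pi fun _ => gaussianReal 0 1) (gaussianVec n σ) ∧
      (∀ i, e i = 0 ∨ e i = 1) ∧ ∑ i, e i = P.trace ∧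
      ∀ x, φ x ⬝ᵥ P *ᵥ φ x = σ ^ 2 * ∑ i, e i * x i ^ 2 := by
  have hH : P.IsHermitian := by
    rw [Matrix.IsHermitian, conjTranspose_eq_transpose_of_trivial]; exact hs
  set U : Matrix (Fin n) (Fin n) ℝ := hH.eigenvectorUnitary.1 with hU
  have hUU : Uᵀ * U = 1 := by
    have := Unitary.coe_star_mul_self hH.eigenvectorUnitary
    rwa [star_eq_conjTranspose, conjTranspose_eq_transpose_of_trivial] at this
  have hdiag : Uᵀ * P * U = diagonal hH.eigenvalues := by
    have := hH.conjStarAlgAut_star_eigenvectorUnitary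
    rw [Unitary.conjStarAlgAut_star_apply, star_eq_conjTranspose,
      conjTranspose_eq_transpose_of_trivial] at this
    exact this
  refine ⟨_, hH.eigenvalues,
    measurePreserving_gaussianVec_orthonormalBasis σ hH.eigenvectorBasis, ?_, ?_, ?_⟩
  · intro i
    have hUU' : U * Uᵀ = 1 := mul_eq_one_comm.mp hUU
    have hsq : diagonal hH.eigenvalues * diagonal hH.eigenvalues = diagonal hH.eigenvalues := by
      rw [← hdiag]
      calc Uᵀ * P * U * (Uᵀ * P * U) = Uᵀ * P * (U * Uᵀ) * P * U := by
            simp only [Matrix.mul_assoc]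
        _ = Uᵀ * (P * P) * U := by rw [hUU']; simp only [Matrix.mul_assoc, Matrix.one_mul]
        _ = Uᵀ * P * U := by rw [hP]
    have h := congrFun (congrFun hsq i) i
    simp only [diagonal_mul_diagonal, diagonal_apply_eq] at h
    have : hH.eigenvalues i * (hH.eigenvalues i - 1) = 0 := by linarith
    rcases mul_eq_zero.mp this with h | h
    · exact Or.inl h
    · exact Or.inr (by linarith)
  · simpa using hH.trace_eq_sum_eigenvalues.symm
  · intro x
    have hφ : (fun j : Fin n => σ * ∑ i, x i * hH.eigenvectorBasis i j) = σ • (U *ᵥ x) := by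
      ext j
      simp [mulVec, dotProduct, hU, mul_comm]
    rw [hφ, mulVec_smul, smul_dotProduct, dotProduct_smul, mulVec_mulVec,
      dotProduct_mulVec, vecMul_mulVec, ← dotProduct_mulVec, ← Matrix.mul_assoc, hdiag]
    simp only [smul_eq_mul, ← mul_assoc, ← sq, dotProduct, mulVec_diagonal]
    congr 1
    exact Finset.sum_congr rfl fun i _ => by ring

lemma integral_exp_mul_sq_gaussianReal {l : ℝ} (hl : l < 1 / 2) :
    ∫ x, exp (l * x ^ 2) ∂gaussianReal 0 1 = (√(1 - 2 * l))⁻¹ := by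
  rw [integral_gaussianReal_eq_integral_smul one_ne_zero]
  have : ∀ x : ℝ, gaussianPDFReal 0 1 x • exp (l * x ^ 2)
      = (√(2 * π))⁻¹ * exp (-(1 / 2 - l) * x ^ 2) := by
    intro x
    simp only [gaussianPDFReal, NNReal.coe_one, mul_one, sub_zero, smul_eq_mul, mul_assoc,
      ← exp_add]
    congr 2
    ring
  simp_rw [this]
  rw [integral_const_mul, integral_gaussian, ← sqrt_inv, ← sqrt_mul (by positivity), ← sqrt_inv]
  congr 1
  have h1 : 1 / 2 - l ≠ 0 := by linarith
  have h2 : 1 - 2 * l ≠ 0 := by linarith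
  field_simp

lemma inv_sqrt_one_sub_le_exp {l : ℝ} (h0 : 0 ≤ l) (hl : l ≤ 1 / 4) :
    (√(1 - 2 * l))⁻¹ ≤ exp (l + 2 * l ^ 2) := by
  rw [← sqrt_inv, sqrt_le_left (exp_pos _).le, ← exp_nat_mul,
    inv_le_iff_one_le_mul₀ (by linarith)]
  have h := quadratic_le_exp_of_nonneg (x := ((2 : ℕ) : ℝ) * (l + 2 * l ^ 2)) (by positivity)
  refine le_trans ?_ (mul_le_mul_of_nonneg_right h (by linarith))
  push_cast
  have : 0 ≤ l ^ 2 * (1 - 2 * l - 4 * l ^ 2 - 8 * l ^ 3) :=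
    mul_nonneg (sq_nonneg _) (by nlinarith [pow_le_pow_left₀ h0 hl 2, pow_le_pow_left₀ h0 hl 3])
  nlinarith

lemma integrable_exp_mul_sq_gaussianReal {l : ℝ} (hl : l < 1 / 2) :
    Integrable (fun x => exp (l * x ^ 2)) (gaussianReal 0 1) := by
  refine .of_integral_ne_zero ?_
  rw [integral_exp_mul_sq_gaussianReal hl]
  have : 0 < 1 - 2 * l := by linarith
  positivity

/-- Moment generating function bound for the chi-squared variable `‖PZ‖² / σ²`. -/
lemma projection_mgf_le {n : ℕ} {σ : ℝ} (hσ : 0 < σ) {P : Matrix (Fin n) (Fin n) ℝ}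
    (hP : P * P = P) (hs : P.IsSymm) {l : ℝ} (h0 : 0 ≤ l) (hl : l ≤ 1 / 4) :
    Integrable (fun z => exp (l * (z ⬝ᵥ P *ᵥ z) / σ ^ 2)) (gaussianVec n σ) ∧
    ∫ z, exp (l * (z ⬝ᵥ P *ᵥ z) / σ ^ 2) ∂gaussianVec n σ
      ≤ exp ((l + 2 * l ^ 2) * P.trace) := by
  obtain ⟨φ, e, hφ, he, htr, hq⟩ := exists_measurePreserving_projection σ hP hs
  have hmeas : Measurable fun z : Fin n → ℝ => exp (l * (z ⬝ᵥ P *ᵥ z) / σ ^ 2) := by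
    unfold mulVec dotProduct; fun_prop
  have hcomp : ∀ x, exp (l * (φ x ⬝ᵥ P *ᵥ φ x) / σ ^ 2) = ∏ i, exp (l * e i * x i ^ 2) := by
    intro x
    rw [hq, ← exp_sum]
    congr 1
    field_simp
    rw [Finset.mul_sum]
    exact Finset.sum_congr rfl fun i _ => by ring
  have hle : ∀ i, l * e i < 1 / 2 := fun i => by
    rcases he i with h | h <;> rw [h] <;> linarith
  constructor
  · rw [← hφ.integrable_comp hmeas.aestronglyMeasurable]
    simp only [Function.comp_def, hcomp]
    exact Integrable.fintype_prod (f := fun i x => exp (l * e i * x ^ 2))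
      fun i => integrable_exp_mul_sq_gaussianReal (hle i)
  · rw [← hφ.map_eq, integral_map hφ.aemeasurable (hmeas.aestronglyMeasurable)]
    simp only [hcomp]
    rw [integral_fintype_prod_eq_prod (fun i x => exp (l * e i * x ^ 2)), ← htr, Finset.mul_sum,
      exp_sum]
    refine Finset.prod_le_prod (fun i _ => integral_nonneg fun x => (exp_pos _).le) fun i _ => ?_
    rw [integral_exp_mul_sq_gaussianReal (hle i)]
    rcases he i with h | h
    · simp [h]
    · simpa [h] using inv_sqrt_one_sub_le_exp h0 hl

/-- `E[ZᵀPZ] = σ² tr P`. -/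
lemma projection_mean {n : ℕ} (σ : ℝ) {P : Matrix (Fin n) (Fin n) ℝ}
    (hP : P * P = P) (hs : P.IsSymm) :
    Integrable (fun z => z ⬝ᵥ P *ᵥ z) (gaussianVec n σ) ∧
    ∫ z, z ⬝ᵥ P *ᵥ z ∂gaussianVec n σ = σ ^ 2 * P.trace := by
  obtain ⟨φ, e, hφ, he, htr, hq⟩ := exists_measurePreserving_projection σ hP hs
  have hmeas : Measurable fun z : Fin n → ℝ => z ⬝ᵥ P *ᵥ z := by
    unfold mulVec dotProduct; fun_prop
  have hsq : Integrable (fun x : ℝ => x ^ 2) (gaussianReal 0 1) :=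
    (memLp_id_gaussianReal 2).integrable_sq
  have hint : ∀ i, Integrable (fun x : Fin n → ℝ => e i * x i ^ 2)
      (Measure.pi fun _ => gaussianReal 0 1) := fun i =>
    (integrable_comp_eval (μ := fun _ : Fin n => gaussianReal 0 1) (i := i) hsq).const_mul _
  have hone : ∫ x : ℝ, x ^ 2 ∂gaussianReal 0 1 = 1 := by
    have h := variance_of_integral_eq_zero (X := fun x : ℝ => x) (μ := gaussianReal 0 1)
      (by fun_prop) (by simp)
    rw [variance_fun_id_gaussianReal] at h
    simpa using h.symm
  constructor
  · rw [← hφ.integrable_comp hmeas.aestronglyMeasurable]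
    simp only [Function.comp_def, hq]
    exact (integrable_finsetSum _ fun i _ => hint i).const_mul _
  · rw [← hφ.map_eq, integral_map hφ.aemeasurable (hmeas.aestronglyMeasurable)]
    simp only [hq]
    rw [integral_const_mul, integral_finsetSum _ fun i _ => hint i, ← htr]
    congr 1
    refine Finset.sum_congr rfl fun i _ => ?_
    rw [integral_const_mul, integral_comp_eval (μ := fun _ : Fin n => gaussianReal 0 1) (i := i)
      hsq.aestronglyMeasurable, hone, mul_one]

/-- Moment generating function of a linear form of a Gaussian vector. -/
lemma linear_mgf {n : ℕ} (σ : ℝ) (a : Fin n → ℝ) :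
    Integrable (fun z => exp (a ⬝ᵥ z)) (gaussianVec n σ) ∧
    ∫ z, exp (a ⬝ᵥ z) ∂gaussianVec n σ = exp (σ ^ 2 * (a ⬝ᵥ a) / 2) := by
  simp only [dotProduct, exp_sum, gaussianVec]
  constructor
  · exact Integrable.fintype_prod (f := fun i x => exp (a i * x))
      fun i => integrable_exp_mul_gaussianReal _
  · rw [integral_fintype_prod_eq_prod (fun i x => exp (a i * x)), Finset.mul_sum, Finset.sum_div,
      exp_sum]
    refine Finset.prod_congr rfl fun i _ => ?_
    have h := congrFun (mgf_id_gaussianReal (μ := 0) (v := (σ ^ 2).toNNReal)) (a i)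
    simp only [mgf, id] at h
    rw [h, coe_toNNReal _ (sq_nonneg σ)]
    congr 1
    ring

lemma linear_mean {n : ℕ} (σ : ℝ) (a : Fin n → ℝ) :
    Integrable (fun z => a ⬝ᵥ z) (gaussianVec n σ) ∧
    ∫ z, a ⬝ᵥ z ∂gaussianVec n σ = 0 := by
  have hint : ∀ i, Integrable (fun z : Fin n → ℝ => a i * z i) (gaussianVec n σ) := fun i =>
    (integrable_eval (μ := fun _ : Fin n => gaussianReal 0 (σ ^ 2).toNNReal) (i := i)
      ((memLp_id_gaussianReal 1).integrable (by simp))).const_mul _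
  refine ⟨integrable_finsetSum _ fun i _ => hint i, ?_⟩
  simp only [dotProduct]
  rw [integral_finsetSum _ fun i _ => hint i]
  refine Finset.sum_eq_zero fun i _ => ?_
  rw [integral_const_mul, gaussianVec, integral_eval (μ := fun _ : Fin n =>
    gaussianReal 0 (σ ^ 2).toNNReal), integral_id_gaussianReal, mul_zero]

section Selection

variable {Ω S : Type*} [MeasurableSpace Ω] {μ : Measure Ω} [Fintype S]
  [MeasurableSpace S] [MeasurableSingletonClass S]

lemma integrable_selection {X : S → Ω → ℝ} {t : Ω → S} (ht : Measurable t)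
    (hX : ∀ s, Integrable (X s) μ) : Integrable (fun ω => X (t ω) ω) μ := by
  have : (fun ω => X (t ω) ω) = fun ω => ∑ s, (t ⁻¹' {s}).indicator (X s) ω := by
    classical
    ext ω
    simp [Set.indicator_apply]
  rw [this]
  exact integrable_finsetSum _ fun s _ => (hX s).indicator (ht (measurableSet_singleton s))

/-- Maximal inequality: variables with exponential moment at most one, evaluated at a random
index, have mean at most `log |S|`. -/
lemma integral_selection_le_log_card [IsProbabilityMeasure μ] [Nonempty S] {X : S → Ω → ℝ}
    {t : Ω → S} (ht : Measurable t) (hX : ∀ s, Integrable (X s) μ)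
    (hexp : ∀ s, Integrable (fun ω => exp (X s ω)) μ) (hle : ∀ s, ∫ ω, exp (X s ω) ∂μ ≤ 1) :
    ∫ ω, X (t ω) ω ∂μ ≤ log (Fintype.card S) := by
  have hc : (0 : ℝ) < Fintype.card S := by exact_mod_cast Fintype.card_pos
  have hsum : Integrable (fun ω => ∑ s, exp (X s ω)) μ :=
    integrable_finsetSum _ fun s _ => hexp s
  have hpt : ∀ ω, X (t ω) ω
      ≤ (log (Fintype.card S) - 1) + (Fintype.card S : ℝ)⁻¹ * ∑ s, exp (X s ω) := by
    intro ω
    have h1 := add_one_le_exp (X (t ω) ω - log (Fintype.card S))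
    rw [exp_sub, exp_log hc] at h1
    have h2 : exp (X (t ω) ω) ≤ ∑ s, exp (X s ω) :=
      Finset.single_le_sum (f := fun s => exp (X s ω)) (fun s _ => (exp_pos _).le)
        (Finset.mem_univ (t ω))
    have h3 := div_le_div_of_nonneg_right h2 hc.le
    rw [div_eq_inv_mul (∑ s, exp (X s ω))] at h3
    linarith
  refine (integral_mono (integrable_selection ht hX)
    ((integrable_const _).add (hsum.const_mul _)) hpt).trans ?_
  simp only [Pi.add_apply]
  rw [integral_add (integrable_const _) (hsum.const_mul _), integral_const_mul,
    integral_finsetSum _ fun s _ => hexp s]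
  have h4 : ∑ s : S, ∫ ω, exp (X s ω) ∂μ ≤ Fintype.card S := by
    simpa using Finset.sum_le_sum fun s (_ : s ∈ Finset.univ) => hle s
  have h5 : (Fintype.card S : ℝ)⁻¹ * ∑ s : S, ∫ ω, exp (X s ω) ∂μ ≤ 1 := by
    rw [inv_mul_le_iff₀ hc]; linarith
  simp
  linarith

end Selection

section Projection

variable {n : ℕ} {P : Matrix (Fin n) (Fin n) ℝ}

lemma residual_dotProduct_projection (hP : P * P = P) (hs : P.IsSymm) (u z : Fin n → ℝ) :
    (u - P *ᵥ u) ⬝ᵥ P *ᵥ z = 0 := by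
  rw [dotProduct_mulVec, ← mulVec_transpose, hs.eq, mulVec_sub, mulVec_mulVec, hP, sub_self,
    zero_dotProduct]

lemma trace_nonneg_of_projection (hP : P * P = P) (hs : P.IsSymm) : 0 ≤ P.trace := by
  obtain ⟨-, e, -, he, htr, -⟩ := exists_measurePreserving_projection 1 hP hs
  rw [← htr]
  exact Finset.sum_nonneg fun i _ => by rcases he i with h | h <;> simp [h]

lemma projection_loss_eq (hP : P * P = P) (hs : P.IsSymm) (θ z : Fin n → ℝ) :
    ∑ i, (P.mulVec (θ + z) i - θ i) ^ 2 = ∑ i, (θ i - P.mulVec θ i) ^ 2 + z ⬝ᵥ P *ᵥ z := by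
  have h1 := residual_dotProduct_projection hP hs θ z
  have h2 := residual_dotProduct_projection hP hs z z
  have key : ∑ i, (P.mulVec (θ + z) i - θ i) ^ 2 = ∑ i, (θ i - P.mulVec θ i) ^ 2
      + z ⬝ᵥ P *ᵥ z - 2 * ((θ - P *ᵥ θ) ⬝ᵥ P *ᵥ z) - (z - P *ᵥ z) ⬝ᵥ P *ᵥ z := by
    simp only [dotProduct, Finset.mul_sum, ← Finset.sum_add_distrib, ← Finset.sum_sub_distrib,
      mulVec_add, Pi.add_apply, Pi.sub_apply]
    exact Finset.sum_congr rfl fun i _ => by ring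
  rw [key, h1, h2]
  ring

lemma projection_residual_eq (hP : P * P = P) (hs : P.IsSymm) (θ z : Fin n → ℝ) :
    ∑ i, ((θ + z) i - P.mulVec (θ + z) i) ^ 2 = ∑ i, (θ i - P.mulVec θ i) ^ 2
      + 2 * ((θ - P *ᵥ θ) ⬝ᵥ z) + z ⬝ᵥ z - z ⬝ᵥ P *ᵥ z := by
  have h1 := residual_dotProduct_projection hP hs θ z
  have h2 := residual_dotProduct_projection hP hs z z
  have key : ∑ i, ((θ + z) i - P.mulVec (θ + z) i) ^ 2 = ∑ i, (θ i - P.mulVec θ i) ^ 2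
      + 2 * ((θ - P *ᵥ θ) ⬝ᵥ z) + z ⬝ᵥ z - z ⬝ᵥ P *ᵥ z
      - 2 * ((θ - P *ᵥ θ) ⬝ᵥ P *ᵥ z) - (z - P *ᵥ z) ⬝ᵥ P *ᵥ z := by
    simp only [dotProduct, Finset.mul_sum, ← Finset.sum_add_distrib, ← Finset.sum_sub_distrib,
      mulVec_add, Pi.add_apply, Pi.sub_apply]
    exact Finset.sum_congr rfl fun i _ => by ring
  rw [key, h1, h2]
  ring

end Projection

/-- Optimizing `8εR + 288εq + 8q/ε` over `ε ∈ (0, 1/2]`. -/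
lemma le_of_forall_eps_bound {A R q : ℝ} (hR : 0 < R) (hq : 0 ≤ q)
    (h : ∀ ε, 0 < ε → ε ≤ 1 / 2 → A ≤ R + 8 * ε * R + 288 * ε * q + 8 * q / ε) :
    A ≤ R + 200 * (√(R * q) + q) := by
  rcases hq.eq_or_lt with rfl | hq
  · simp only [mul_zero, sqrt_zero, add_zero, zero_div] at h ⊢
    refine le_of_forall_pos_le_add fun δ hδ => ?_
    have hpos : 0 < min (1 / 2) (δ / (8 * R)) := by positivity
    have h1 := h _ hpos (min_le_left _ _)
    have h2 : min (1 / 2) (δ / (8 * R)) * (8 * R) ≤ δ := by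
      rw [← le_div_iff₀ (by positivity)]; exact min_le_right _ _
    linarith
  · rcases le_or_gt (4 * q) R with hle | hlt
    · set r := √(R * q) with hr
      have hr2 : r ^ 2 = R * q := sq_sqrt (by positivity)
      have hrpos : 0 < r := sqrt_pos.mpr (by positivity)
      have hε : r / R ≤ 1 / 2 := by
        rw [div_le_iff₀ hR]
        nlinarith
      have h1 := h (r / R) (by positivity) hε
      have h2 : 8 * (r / R) * R = 8 * r := by field_simp
      have h3 : 8 * q / (r / R) = 8 * r := by
        field_simp
        linarith
      have h4 : 288 * (r / R) * q ≤ 144 * q := by nlinarith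
      rw [h2, h3] at h1
      linarith
    · have h1 := h (1 / 2) (by norm_num) le_rfl
      have h2 : 8 * q / (1 / 2) = 16 * q := by ring
      rw [h2] at h1
      have := sqrt_nonneg (R * q)
      linarith

section Oracle

variable {n : ℕ} {σ : ℝ} {S : Type} {H : S → Matrix (Fin n) (Fin n) ℝ}

lemma trace_le_riskP (θ₀ : Fin n → ℝ) (s : S) : σ ^ 2 * (H s).trace ≤ riskP σ θ₀ H s :=
  le_add_of_nonneg_left (Finset.sum_nonneg fun _ _ => sq_nonneg _)

lemma bias_le_riskP (hP : ∀ s, H s * H s = H s) (hs : ∀ s, (H s).IsSymm) (θ₀ : Fin n → ℝ)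
    (s : S) : (θ₀ - H s *ᵥ θ₀) ⬝ᵥ (θ₀ - H s *ᵥ θ₀) ≤ riskP σ θ₀ H s := by
  have h := mul_nonneg (sq_nonneg σ) (trace_nonneg_of_projection (hP s) (hs s))
  have : (θ₀ - H s *ᵥ θ₀) ⬝ᵥ (θ₀ - H s *ᵥ θ₀) = ∑ i, (θ₀ i - (H s).mulVec θ₀ i) ^ 2 := by
    simp [dotProduct, sq]
  rw [this, riskP]
  linarith

variable [Fintype S] [Nonempty S] [MeasurableSpace S] [MeasurableSingletonClass S]

/-- If `f s` has `E exp (ε (f s - ε R s) / (2σ²)) ≤ 1` for each `s`, then at a random index it is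
on average at most `ε R + 2σ² log |S| / ε`. -/
lemma integral_selection_le_of_mgf {Ω : Type*} [MeasurableSpace Ω] {μ : Measure Ω}
    [IsProbabilityMeasure μ] (hσ : 0 < σ) {f : S → Ω → ℝ} {R : S → ℝ} {t : Ω → S}
    (ht : Measurable t) (hf : ∀ s, Integrable (f s) μ) {ε : ℝ} (hε : 0 < ε)
    (hexp : ∀ s, Integrable (fun ω => exp (ε / 2 * f s ω / σ ^ 2)) μ)
    (hle : ∀ s, ∫ ω, exp (ε / 2 * f s ω / σ ^ 2) ∂μ ≤ exp (ε ^ 2 / 2 * R s / σ ^ 2)) :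
    ∫ ω, f (t ω) ω ∂μ
      ≤ ε * ∫ ω, R (t ω) ∂μ + 2 * (σ ^ 2 * log (Fintype.card S)) / ε := by
  have hfi := integrable_selection ht hf
  have hRi := integrable_selection (μ := μ) ht fun s => integrable_const (R s)
  have hsplit : ∀ s ω, exp (ε / (2 * σ ^ 2) * (f s ω - ε * R s))
      = exp (-(ε ^ 2 / 2 * R s / σ ^ 2)) * exp (ε / 2 * f s ω / σ ^ 2) := by
    intro s ω
    rw [← exp_add]
    congr 1
    field_simp
    ring
  have h := integral_selection_le_log_card (μ := μ)
    (X := fun s ω => ε / (2 * σ ^ 2) * (f s ω - ε * R s)) ht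
    (fun s => ((hf s).sub (integrable_const _)).const_mul _)
    (fun s => by simpa only [hsplit] using (hexp s).const_mul _)
    (fun s => by
      simp only [hsplit]
      rw [integral_const_mul, exp_neg, inv_mul_le_iff₀ (exp_pos _), mul_one]
      exact hle s)
  rw [integral_const_mul, integral_sub hfi (hRi.const_mul _), integral_const_mul,
    div_mul_eq_mul_div, div_le_iff₀ (by positivity)] at h
  rw [← sub_le_iff_le_add', le_div_iff₀ hε]
  linarith

/-- Centred quadratic form `‖H Z‖² - σ² tr H` at a data-dependent index. -/
lemma integral_selected_chaos_le (hσ : 0 < σ) (θ₀ : Fin n → ℝ) (hP : ∀ s, H s * H s = H s)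
    (hs : ∀ s, (H s).IsSymm) {t : (Fin n → ℝ) → S} (ht : Measurable t) {ε : ℝ} (hε : 0 < ε)
    (hε' : ε ≤ 1 / 2) :
    ∫ z, (z ⬝ᵥ H (t z) *ᵥ z - σ ^ 2 * (H (t z)).trace) ∂gaussianVec n σ
      ≤ ε * ∫ z, riskP σ θ₀ H (t z) ∂gaussianVec n σ
        + 2 * (σ ^ 2 * log (Fintype.card S)) / ε := by
  have hsplit : ∀ s z, exp (ε / 2 * (z ⬝ᵥ H s *ᵥ z - σ ^ 2 * (H s).trace) / σ ^ 2)
      = exp (-(ε / 2 * (H s).trace)) * exp (ε / 2 * (z ⬝ᵥ H s *ᵥ z) / σ ^ 2) := by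
    intro s z
    rw [← exp_add]
    congr 1
    field_simp
    ring
  have hmgf := fun s => projection_mgf_le hσ (hP s) (hs s) (l := ε / 2) (by linarith)
    (by linarith)
  refine integral_selection_le_of_mgf hσ
    (f := fun s z => z ⬝ᵥ H s *ᵥ z - σ ^ 2 * (H s).trace) (R := riskP σ θ₀ H) ht
    (fun s => (projection_mean σ (hP s) (hs s)).1.sub (integrable_const _)) hε
    (fun s => ?_) fun s => ?_
  · simpa only [hsplit] using (hmgf s).1.const_mul _
  · simp only [hsplit]
    rw [integral_const_mul]
    refine (mul_le_mul_of_nonneg_left (hmgf s).2 (exp_pos _).le).trans ?_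
    rw [← exp_add, exp_le_exp, le_div_iff₀ (by positivity)]
    have := mul_le_mul_of_nonneg_left (trace_le_riskP (σ := σ) (H := H) θ₀ s)
      (show 0 ≤ ε ^ 2 / 2 by positivity)
    linarith

/-- Linear form `-⟨(I - H)θ₀, Z⟩` at a data-dependent index. -/
lemma integral_selected_linear_le (hσ : 0 < σ) (θ₀ : Fin n → ℝ) (hP : ∀ s, H s * H s = H s)
    (hs : ∀ s, (H s).IsSymm) {t : (Fin n → ℝ) → S} (ht : Measurable t) {ε : ℝ} (hε : 0 < ε) :
    ∫ z, -((θ₀ - H (t z) *ᵥ θ₀) ⬝ᵥ z) ∂gaussianVec n σ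
      ≤ ε * ∫ z, riskP σ θ₀ H (t z) ∂gaussianVec n σ
        + 2 * (σ ^ 2 * log (Fintype.card S)) / ε := by
  have hlin : ∀ s z, ε / 2 * -((θ₀ - H s *ᵥ θ₀) ⬝ᵥ z) / σ ^ 2
      = (-(ε / 2 / σ ^ 2) • (θ₀ - H s *ᵥ θ₀)) ⬝ᵥ z := by
    intro s z
    rw [smul_dotProduct, smul_eq_mul]
    ring
  refine integral_selection_le_of_mgf hσ (f := fun s z => -((θ₀ - H s *ᵥ θ₀) ⬝ᵥ z))
    (R := riskP σ θ₀ H) ht (fun s => (linear_mean σ _).1.neg) hε (fun s => ?_) fun s => ?_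
  · simpa only [hlin] using (linear_mgf σ _).1
  · simp only [hlin]
    rw [(linear_mgf σ _).2, exp_le_exp, smul_dotProduct, dotProduct_smul, smul_eq_mul,
      smul_eq_mul]
    have h := bias_le_riskP (σ := σ) hP hs θ₀ s
    have h0 : 0 ≤ (θ₀ - H s *ᵥ θ₀) ⬝ᵥ (θ₀ - H s *ᵥ θ₀) := by
      simpa using dotProduct_self_star_nonneg (θ₀ - H s *ᵥ θ₀)
    have hpos : 0 < ε ^ 2 / σ ^ 2 := by positivity
    calc σ ^ 2 * (-(ε / 2 / σ ^ 2) * (-(ε / 2 / σ ^ 2)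
            * ((θ₀ - H s *ᵥ θ₀) ⬝ᵥ (θ₀ - H s *ᵥ θ₀)))) / 2
        = ε ^ 2 / σ ^ 2 * ((θ₀ - H s *ᵥ θ₀) ⬝ᵥ (θ₀ - H s *ᵥ θ₀) / 8) := by
          field_simp
          ring
      _ ≤ ε ^ 2 / σ ^ 2 * (riskP σ θ₀ H s / 2) := by
          refine mul_le_mul_of_nonneg_left ?_ hpos.le
          linarith
      _ = ε ^ 2 / 2 * riskP σ θ₀ H s / σ ^ 2 := by ring

end Oracle

/-- risk bound for SURE-tuned projection estimators:
`Risk(θ̂_{sh}) ≤ R(s₀) + C(√(R(s₀)σ² log|S|)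
  + σ² log|S|(1 + log₊(σ² log|S| / R(s₀))))` where `s₀` is the risk minimizer
with `tr(H_{s₀}) ≥ 1`. -/
theorem risk_bound_SURE_tuned_projection :
    ∃ C : ℝ, 0 < C ∧
      ∀ (n : ℕ) (σ : ℝ), 0 < σ →
      ∀ (θ₀ : Fin n → ℝ)
        (S : Type) [Fintype S] [Nonempty S]
        [MeasurableSpace S] [MeasurableSingletonClass S]
        (H : S → Matrix (Fin n) (Fin n) ℝ),
        (∀ s, H s * H s = H s) → (∀ s, (H s).IsSymm) →
        ∀ (s₀ : S), (∀ s, riskP σ θ₀ H s₀ ≤ riskP σ θ₀ H s) →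
        1 ≤ (H s₀).trace →
        ∀ (sh : (Fin n → ℝ) → S), Measurable sh →
        (∀ y, SUREf σ H (sh y) y = ⨅ s, SUREf σ H s y) →
        (∫ z, (∑ i, ((H (sh (θ₀ + z))).mulVec (θ₀ + z) i - θ₀ i) ^ 2)
            ∂(gaussianVec n σ))
          ≤ riskP σ θ₀ H s₀
            + C * (Real.sqrt (riskP σ θ₀ H s₀ * (σ ^ 2 * Real.log (Fintype.card S)))
               + σ ^ 2 * Real.log (Fintype.card S)
                 * (1 + max 0 (Real.log
                      (σ ^ 2 * Real.log (Fintype.card S) / riskP σ θ₀ H s₀)))) := by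
  refine ⟨200, by norm_num, ?_⟩
  intro n σ hσ θ₀ S _ _ _ _ H hP hs s₀ _ htr sh hsh hmin
  set q := σ ^ 2 * Real.log (Fintype.card S)
  set γ := gaussianVec n σ
  have hcard : (1 : ℝ) ≤ Fintype.card S := by exact_mod_cast Fintype.card_pos
  have hq0 : 0 ≤ q := mul_nonneg (sq_nonneg _) (log_nonneg hcard)
  have hR0 : 0 < riskP σ θ₀ H s₀ :=
    (by positivity : 0 < σ ^ 2 * (H s₀).trace).trans_le (trace_le_riskP θ₀ s₀)
  set t : (Fin n → ℝ) → S := fun z => sh (θ₀ + z) with ht_def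
  have ht : Measurable t := hsh.comp (by fun_prop)
  set R : S → ℝ := riskP σ θ₀ H with hR
  set W : S → (Fin n → ℝ) → ℝ := fun s z => z ⬝ᵥ H s *ᵥ z - σ ^ 2 * (H s).trace with hW
  set G : S → (Fin n → ℝ) → ℝ := fun s z => (θ₀ - H s *ᵥ θ₀) ⬝ᵥ z with hG
  have hWint : ∀ s, Integrable (W s) γ := fun s =>
    (projection_mean σ (hP s) (hs s)).1.sub (integrable_const _)
  have hGint : ∀ s, Integrable (G s) γ := fun s => (linear_mean σ _).1
  have hW0 : ∫ z, W s₀ z ∂γ = 0 := by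
    rw [integral_sub (projection_mean σ (hP s₀) (hs s₀)).1 (integrable_const _),
      (projection_mean σ (hP s₀) (hs s₀)).2]
    simp
  have hG0 : ∫ z, G s₀ z ∂γ = 0 := (linear_mean σ _).2
  have hRt : Integrable (fun z => R (t z)) γ :=
    integrable_selection ht fun s => integrable_const (R s)
  have hWt : Integrable (fun z => W (t z) z) γ := integrable_selection ht hWint
  have hGt : Integrable (fun z => G (t z) z) γ := integrable_selection ht hGint
  have hloss : ∀ z, ∑ i, ((H (sh (θ₀ + z))).mulVec (θ₀ + z) i - θ₀ i) ^ 2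
      = R (t z) + W (t z) z := by
    intro z
    rw [projection_loss_eq (hP _) (hs _)]
    simp only [hR, hW, riskP, ht_def]
    ring
  have hsure : ∀ s z, SUREf σ H s (θ₀ + z) = R s + 2 * G s z - W s z + z ⬝ᵥ z := by
    intro s z
    rw [SUREf, projection_residual_eq (hP _) (hs _)]
    simp only [hR, hW, hG, riskP]
    ring
  have hcompare : ∀ z, R (t z) ≤ R s₀ + 2 * G s₀ z - W s₀ z + W (t z) z - 2 * G (t z) z := by
    intro z
    have h : SUREf σ H (t z) (θ₀ + z) ≤ SUREf σ H s₀ (θ₀ + z) :=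
      (hmin (θ₀ + z)).trans_le (ciInf_le (Set.finite_range _).bddBelow s₀)
    rw [hsure, hsure] at h
    linarith
  have hmean : ∫ z, R (t z) ∂γ
      ≤ R s₀ + ∫ z, W (t z) z ∂γ + 2 * ∫ z, -G (t z) z ∂γ := by
    have h1 := (integrable_const (μ := γ) (R s₀)).add ((hGint s₀).const_mul 2)
    have h2 := h1.sub (hWint s₀)
    have h3 := h2.add hWt
    refine (integral_mono hRt (h3.sub (hGt.const_mul 2)) hcompare).trans (le_of_eq ?_)
    rw [integral_sub' h3 (hGt.const_mul 2), integral_add' h2 hWt, integral_sub' h1 (hWint s₀),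
      integral_add' (integrable_const _) ((hGint s₀).const_mul 2), integral_const_mul,
      integral_const_mul, hG0, hW0, integral_neg]
    simp
    ring
  have hchaos : ∀ ε, 0 < ε → ε ≤ 1 / 2 →
      ∫ z, W (t z) z ∂γ ≤ ε * ∫ z, R (t z) ∂γ + 2 * q / ε := fun ε h1 h2 =>
    integral_selected_chaos_le hσ θ₀ hP hs ht h1 h2
  have hlin : ∀ ε, 0 < ε →
      ∫ z, -G (t z) z ∂γ ≤ ε * ∫ z, R (t z) ∂γ + 2 * q / ε := fun ε h1 =>
    integral_selected_linear_le hσ θ₀ hP hs ht h1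
  have hRmean : ∫ z, R (t z) ∂γ ≤ 2 * R s₀ + 72 * q := by
    have h1 := hchaos (1 / 6) (by norm_num) (by norm_num)
    have h2 := hlin (1 / 6) (by norm_num)
    have h3 : 2 * q / (1 / 6) = 12 * q := by ring
    rw [h3] at h1 h2
    linarith
  simp only [hloss]
  rw [integral_add hRt hWt]
  have hmain := le_of_forall_eps_bound (A := ∫ z, R (t z) ∂γ + ∫ z, W (t z) z ∂γ) hR0 hq0
    fun ε hε hε' => by
      have h1 := hchaos ε hε hε'
      have h2 := hlin ε hε
      have h3 := mul_le_mul_of_nonneg_left hRmean hε.le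
      have h4 : 8 * q / ε = 4 * (2 * q / ε) := by ring
      rw [h4]
      linarith
  refine hmain.trans ?_
  gcongr
  exact le_mul_of_one_le_right hq0 (le_add_of_nonneg_right (le_max_left _ _))
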